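/- Let α > 0 and set γ_α = 6 H_α″(-c_α)/H_α‴(-c_α). Then lim_{ξ ↓ s_α} f_α(ξ)/√(ξ − s_α) = √2/( π c_α √(s_α − c_α²) ). -/

import Mathlib

open MeasureTheory Set Filter

/-- `F(x+iy) = ∫₀^∞ t e^{-t}/((x-t)² + y²) dt`. -/
noncomputable def Fint (x y : ℝ) : ℝ :=
  ∫ t in Set.Ioi (0:ℝ), t * Real.exp (-t) / ((x - t)^2 + y^2)

/-- `H_α(z) = z + α + α ∫₀^∞ t e^{-t}/(z-t) dt`. -/
noncomputable def Hfun (α : ℝ) (z : ℂ) : ℂ :=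
  z + (α : ℂ) + (α : ℂ) * ∫ t in Set.Ioi (0:ℝ), ((t * Real.exp (-t) : ℝ) : ℂ) / (z - (t : ℂ))

lemma gm_int : IntegrableOn (fun t : ℝ => t * Real.exp (-t)) (Ioi 0) := by
  have h := Real.GammaIntegral_convergent (s := 2) (by norm_num)
  refine h.congr_fun (fun t _ => ?_) measurableSet_Ioi
  norm_num
  ring

lemma gm_one : ∫ t in Ioi (0:ℝ), t * Real.exp (-t) = 1 := by
  have h := Real.Gamma_eq_integral (s := 2) (by norm_num)
  rw [Real.Gamma_two] at h
  rw [h]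
  refine setIntegral_congr_fun measurableSet_Ioi (fun t _ => ?_)
  norm_num
  ring

lemma gm_int_real (g : ℝ → ℝ) (hg : Measurable g) (B : ℝ) (hB : ∀ t, 0 < t → |g t| ≤ B) :
    IntegrableOn (fun t : ℝ => g t * (t * Real.exp (-t))) (Ioi 0) := by
  refine Integrable.bdd_mul (c := B) gm_int hg.aestronglyMeasurable ?_
  filter_upwards [ae_restrict_mem measurableSet_Ioi] with t ht
  exact hB t ht

lemma gm_int_cplx (g : ℝ → ℂ) (hg : Measurable g) (B : ℝ) (hB : ∀ t : ℝ, 0 < t → ‖g t‖ ≤ B) :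
    IntegrableOn (fun t : ℝ => g t * ((t * Real.exp (-t) : ℝ) : ℂ)) (Ioi 0) := by
  refine Integrable.bdd_mul (c := B) gm_int.ofReal hg.aestronglyMeasurable ?_
  filter_upwards [ae_restrict_mem measurableSet_Ioi] with t ht
  exact hB t ht

lemma int_pos_of_pos (g : ℝ → ℝ) (hi : IntegrableOn g (Ioi 0)) (hg : ∀ t, 0 < t → 0 < g t) :
    0 < ∫ t in Ioi (0:ℝ), g t := by
  rw [setIntegral_pos_iff_support_of_nonneg_ae _ hi]
  · have : Function.support g ∩ Ioi 0 = Ioi 0 := by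
      ext t
      simp only [mem_inter_iff, Function.mem_support, mem_Ioi, and_iff_right_iff_imp]
      exact fun h => (hg t h).ne'
    rw [this]
    simp
  · filter_upwards [ae_restrict_mem measurableSet_Ioi] with t ht
    exact (hg t ht).le

/-- points uniformly away from the positive axis -/
def Away (z : ℂ) : Prop := ∃ δ : ℝ, 0 < δ ∧ ∀ t : ℝ, 0 < t → δ ≤ ‖z - t‖

lemma Away.ne {z : ℂ} (hz : Away z) (t : ℝ) (ht : 0 < t) : z - t ≠ 0 := by
  obtain ⟨δ, hδ, h⟩ := hz
  have := h t ht
  intro h0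
  rw [h0, norm_zero] at this
  linarith

lemma away_of_im {z : ℂ} (h : 0 < z.im) : Away z := by
  refine ⟨z.im, h, fun t _ => ?_⟩
  have := Complex.abs_im_le_norm (z - t)
  simp only [Complex.sub_im, Complex.ofReal_im, sub_zero] at this
  exact (le_abs_self _).trans this

lemma away_of_re {z : ℂ} {d : ℝ} (hd : 0 < d) (h : z.re ≤ -d) :
    ∀ t : ℝ, 0 < t → d ≤ ‖z - t‖ := by
  intro t ht
  have := Complex.abs_re_le_norm (z - t)
  simp only [Complex.sub_re, Complex.ofReal_re] at this
  have h2 := neg_abs_le (z.re - t)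
  linarith

lemma int_one {z : ℂ} (hz : Away z) :
    IntegrableOn (fun t : ℝ => ((t * Real.exp (-t) : ℝ) : ℂ) / (z - t)) (Ioi 0) := by
  obtain ⟨δ, hδ, h⟩ := hz
  have := gm_int_cplx (fun t => (z - t)⁻¹) (by fun_prop) δ⁻¹ (fun t ht => by
    rw [norm_inv]; exact inv_anti₀ hδ (h t ht))
  refine this.congr_fun (fun t _ => ?_) measurableSet_Ioi
  simp only [div_eq_mul_inv]; ring

lemma int_two {z w : ℂ} (hz : Away z) (hw : Away w) :
    IntegrableOn (fun t : ℝ => ((t * Real.exp (-t) : ℝ) : ℂ) / ((z - t) * (w - t))) (Ioi 0) := by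
  obtain ⟨δ, hδ, h⟩ := hz
  obtain ⟨ε, hε, h'⟩ := hw
  have := gm_int_cplx (fun t => (z - t)⁻¹ * (w - t)⁻¹) (by fun_prop) (δ⁻¹ * ε⁻¹) (fun t ht => by
    rw [norm_mul, norm_inv, norm_inv]
    have h1 := inv_anti₀ hδ (h t ht)
    have h2 := inv_anti₀ hε (h' t ht)
    gcongr)
  refine this.congr_fun (fun t _ => ?_) measurableSet_Ioi
  simp only [div_eq_mul_inv, mul_inv]; ring

lemma int_normsq {z : ℂ} (hz : Away z) :
    IntegrableOn (fun t : ℝ => t * Real.exp (-t) / ((z.re - t)^2 + z.im^2)) (Ioi 0) := by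
  obtain ⟨δ, hδ, h⟩ := hz
  have := gm_int_real (fun t => ((z.re - t)^2 + z.im^2)⁻¹) (by fun_prop) ((δ^2)⁻¹) (fun t ht => by
    rw [abs_of_nonneg (by positivity)]
    refine inv_anti₀ (by positivity) ?_
    have h1 := h t ht
    have h2 : ‖z - t‖^2 = (z.re - t)^2 + z.im^2 := by
      rw [← Complex.normSq_eq_norm_sq, Complex.normSq_apply]
      simp; ring
    rw [← h2]
    gcongr)
  refine this.congr_fun (fun t _ => ?_) measurableSet_Ioi
  simp only [div_eq_mul_inv]; ring

lemma H_sub (α : ℝ) {z w : ℂ} (hz : Away z) (hw : Away w) :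
    Hfun α z - Hfun α w = (z - w) * (1 - α * ∫ t in Ioi (0:ℝ),
      ((t * Real.exp (-t) : ℝ) : ℂ) / ((z - t) * (w - t))) := by
  have key : (∫ t in Ioi (0:ℝ), ((t * Real.exp (-t) : ℝ) : ℂ) / (z - t))
      - (∫ t in Ioi (0:ℝ), ((t * Real.exp (-t) : ℝ) : ℂ) / (w - t))
      = (w - z) * ∫ t in Ioi (0:ℝ), ((t * Real.exp (-t) : ℝ) : ℂ) / ((z - t) * (w - t)) := by
    rw [← integral_sub (int_one hz) (int_one hw), ← integral_const_mul]
    refine setIntegral_congr_fun measurableSet_Ioi (fun t ht => ?_)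
    have h1 := hz.ne t ht
    have h2 := hw.ne t ht
    field_simp
    ring
  unfold Hfun
  linear_combination (α : ℂ) * key

/-- second order kernel -/
noncomputable def Kf (c : ℝ) (z : ℂ) : ℂ :=
  ∫ t in Ioi (0:ℝ), ((t * Real.exp (-t) : ℝ) : ℂ) / ((((-c : ℝ) : ℂ) - t)^2 * (z - t))

lemma away_c {c : ℝ} (hc : 0 < c) : Away ((-c : ℝ) : ℂ) :=
  ⟨c, hc, away_of_re hc (by simp)⟩

lemma H_sub_c (α : ℝ) (hα : 0 < α) (c : ℝ) (hc : 0 < c)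
    (hceq : (∫ t in Set.Ioi (0:ℝ), t * Real.exp (-t) / (c + t)^2) = 1/α) {z : ℂ} (hz : Away z) :
    Hfun α z - Hfun α ((-c : ℝ) : ℂ) = (z - ((-c : ℝ) : ℂ))^2 * (α * Kf c z) := by
  have hw := away_c hc
  rw [H_sub α hz hw]
  have h1 : (∫ t in Ioi (0:ℝ), ((t * Real.exp (-t) : ℝ) : ℂ) /
      ((((-c : ℝ) : ℂ) - t) * (((-c : ℝ) : ℂ) - t))) = ((1 / α : ℝ) : ℂ) := by
    rw [← hceq, ← integral_complex_ofReal]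
    refine setIntegral_congr_fun measurableSet_Ioi (fun t ht => ?_)
    push_cast
    congr 1
    ring
  have h2 : (∫ t in Ioi (0:ℝ), ((t * Real.exp (-t) : ℝ) : ℂ) /
      ((((-c : ℝ) : ℂ) - t) * (((-c : ℝ) : ℂ) - t)))
      - (∫ t in Ioi (0:ℝ), ((t * Real.exp (-t) : ℝ) : ℂ) / ((z - t) * (((-c : ℝ) : ℂ) - t)))
      = (z - ((-c : ℝ) : ℂ)) * Kf c z := by
    unfold Kf
    rw [← integral_sub (int_two hw hw) (int_two hz hw), ← integral_const_mul]
    refine setIntegral_congr_fun measurableSet_Ioi (fun t ht => ?_)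
    have h1 := hz.ne t ht
    have h2 := hw.ne t ht
    field_simp
    ring
  rw [h1] at h2
  have h3 : (α : ℂ) * ((1 / α : ℝ) : ℂ) = 1 := by
    rw [← Complex.ofReal_mul, mul_one_div_cancel hα.ne', Complex.ofReal_one]
  linear_combination (z - ((-c : ℝ) : ℂ)) * (α * h2 - h3)

lemma re_A_le (α : ℝ) (hα : 0 < α) {z w : ℂ} (hz : Away z) (hw : Away w)
    (hFz : Fint z.re z.im ≤ 1/α) (hFw : Fint w.re w.im ≤ 1/α) :
    0 ≤ (1 - α * ∫ t in Ioi (0:ℝ),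
      ((t * Real.exp (-t) : ℝ) : ℂ) / ((z - t) * (w - t)) : ℂ).re := by
  have h1 : (∫ t in Ioi (0:ℝ), ((t * Real.exp (-t) : ℝ) : ℂ) / ((z - t) * (w - t))).re
      ≤ 1/α := by
    have hre := integral_re (int_two hz hw)
    simp only [RCLike.re_to_complex] at hre
    rw [← hre]
    have h2 : ∫ t in Ioi (0:ℝ), (((t * Real.exp (-t) : ℝ) : ℂ) / ((z - t) * (w - t))).re ≤
        ∫ t in Ioi (0:ℝ), ((1/2) * (t * Real.exp (-t) / ((z.re - t)^2 + z.im^2)) +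
          (1/2) * (t * Real.exp (-t) / ((w.re - t)^2 + w.im^2))) := by
      refine setIntegral_mono_on (int_two hz hw).re
        (((int_normsq hz).const_mul _).add ((int_normsq hw).const_mul _)) measurableSet_Ioi ?_
      intro t ht
      have ht' : 0 < t := ht
      have hn : ∀ u : ℂ, (u.re - t)^2 + u.im^2 = ‖u - t‖^2 := by
        intro u
        rw [← Complex.normSq_eq_norm_sq, Complex.normSq_apply]
        simp; ring
      rw [hn, hn]
      refine (Complex.re_le_norm _).trans ?_
      rw [norm_div, norm_mul, Complex.norm_real, Real.norm_of_nonneg (by positivity)]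
      have hm : 0 ≤ t * Real.exp (-t) := by positivity
      have := mul_nonneg hm (sq_nonneg (‖z - t‖⁻¹ - ‖w - t‖⁻¹))
      simp only [div_eq_mul_inv, mul_inv, ← inv_pow]
      nlinarith
    refine h2.trans ?_
    rw [integral_add ((int_normsq hz).const_mul _) ((int_normsq hw).const_mul _),
      integral_const_mul, integral_const_mul]
    unfold Fint at hFz hFw
    linarith
  simp only [Complex.sub_re, Complex.one_re, Complex.re_ofReal_mul]
  have := mul_le_mul_of_nonneg_left h1 hα.le
  rw [mul_one_div_cancel hα.ne'] at this
  linarith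

lemma Kf_tendsto (c : ℝ) (hc : 0 < c) :
    ContinuousAt (Kf c) ((-c : ℝ) : ℂ) := by
  unfold ContinuousAt Kf
  refine tendsto_integral_filter_of_dominated_convergence
    (fun t => (c^2 * (c/2))⁻¹ * (t * Real.exp (-t))) ?_ ?_ ?_ ?_
  · refine Eventually.of_forall (fun z => Measurable.aestronglyMeasurable ?_)
    fun_prop
  · have : ∀ᶠ z : ℂ in nhds ((-c : ℝ) : ℂ), z.re < -(c/2) := by
      refine Complex.continuous_re.continuousAt.eventually_lt continuousAt_const ?_
      simp; linarith
    filter_upwards [this] with z hz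
    filter_upwards [ae_restrict_mem measurableSet_Ioi] with t ht
    have ht' : 0 < t := ht
    have h1 := away_of_re (half_pos hc) hz.le t ht
    have h2 := away_of_re (z := ((-c : ℝ) : ℂ)) hc (by simp) t ht
    rw [norm_div, norm_mul, norm_pow, Complex.norm_real, Real.norm_of_nonneg (by positivity),
      div_eq_mul_inv, mul_comm]
    gcongr
  · exact gm_int.const_mul _
  · filter_upwards [ae_restrict_mem measurableSet_Ioi] with t ht
    have h := (away_c hc).ne t ht
    have : ContinuousAt (fun z : ℂ => ((t * Real.exp (-t) : ℝ) : ℂ) /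
      ((((-c : ℝ) : ℂ) - t)^2 * (z - t))) ((-c : ℝ) : ℂ) := by
      refine ContinuousAt.div (by fun_prop) (by fun_prop) ?_
      exact mul_ne_zero (pow_ne_zero _ h) h
    exact this

lemma Fint_tendsto (c ε : ℝ) (hε : 0 < ε) :
    ContinuousAt (fun x => Fint x ε) (-c) := by
  unfold ContinuousAt Fint
  refine tendsto_integral_filter_of_dominated_convergence
    (fun t => (ε^2)⁻¹ * (t * Real.exp (-t))) ?_ ?_ ?_ ?_
  · refine Eventually.of_forall (fun z => Measurable.aestronglyMeasurable ?_)
    fun_prop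
  · refine Eventually.of_forall (fun x => ?_)
    filter_upwards [ae_restrict_mem measurableSet_Ioi] with t ht
    have ht' : 0 < t := ht
    rw [Real.norm_of_nonneg (by positivity), div_eq_mul_inv, mul_comm]
    gcongr
    nlinarith [sq_nonneg (x - t)]
  · exact gm_int.const_mul _
  · filter_upwards [ae_restrict_mem measurableSet_Ioi] with t ht
    have : ContinuousAt (fun x : ℝ => t * Real.exp (-t) / ((x - t)^2 + ε^2)) (-c) := by
      refine ContinuousAt.div (by fun_prop) (by fun_prop) ?_
      positivity
    exact this

lemma int_c (c : ℝ) (hc : 0 < c) (n : ℕ) :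
    IntegrableOn (fun t : ℝ => t * Real.exp (-t) / (c + t)^n) (Ioi 0) := by
  have := gm_int_real (fun t => ((c + t)^n)⁻¹) (by fun_prop) ((c^n)⁻¹) (fun t ht => by
    rw [abs_of_nonneg (by positivity)]
    gcongr
    linarith)
  refine this.congr_fun (fun t _ => ?_) measurableSet_Ioi
  simp only [div_eq_mul_inv]; ring

lemma Kf_val (c : ℝ) : Kf c ((-c : ℝ) : ℂ) =
    ((-(∫ t in Ioi (0:ℝ), t * Real.exp (-t) / (c + t)^3) : ℝ) : ℂ) := by
  unfold Kf
  rw [← integral_neg, ← integral_complex_ofReal]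
  refine setIntegral_congr_fun measurableSet_Ioi (fun t ht => ?_)
  push_cast
  rw [← div_neg]
  congr 1
  ring

lemma ibp (c : ℝ) (hc : 0 < c) :
    1 - (∫ t in Ioi (0:ℝ), t * Real.exp (-t) / (c + t)^1)
     - (c + c^2) * (∫ t in Ioi (0:ℝ), t * Real.exp (-t) / (c + t)^2)
     - 2 * c^2 * (∫ t in Ioi (0:ℝ), t * Real.exp (-t) / (c + t)^3) = 0 := by
  have i1 := int_c c hc 1
  have i2 := int_c c hc 2
  have i3 := int_c c hc 3
  set g : ℝ → ℝ := fun t => t * Real.exp (-t) - t * Real.exp (-t) / (c + t)^1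
    - (c + c^2) * (t * Real.exp (-t) / (c + t)^2)
    - 2 * c^2 * (t * Real.exp (-t) / (c + t)^3) with hg
  have hint : IntegrableOn g (Ioi 0) :=
    ((gm_int.sub i1).sub (i2.const_mul _)).sub (i3.const_mul _)
  have hsum : ∫ t in Ioi (0:ℝ), g t =  1 - (∫ t in Ioi (0:ℝ), t * Real.exp (-t) / (c + t)^1)
     - (c + c^2) * (∫ t in Ioi (0:ℝ), t * Real.exp (-t) / (c + t)^2)
     - 2 * c^2 * (∫ t in Ioi (0:ℝ), t * Real.exp (-t) / (c + t)^3) := by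
    have e1 := integral_sub ((gm_int.sub i1).sub (i2.const_mul (c + c^2)))
      (i3.const_mul (2 * c^2))
    have e2 := integral_sub (gm_int.sub i1) (i2.const_mul (c + c^2))
    have e3 := integral_sub gm_int i1
    simp only [Pi.sub_apply, integral_const_mul] at e1 e2 e3
    rw [gm_one] at e3
    rw [e3] at e2
    rw [e2] at e1
    exact e1
  rw [← hsum]
  -- antiderivative
  have := integral_Ioi_of_hasDerivAt_of_tendsto' (a := 0) (m := 0) (f' := g)
    (f := fun t => -(t^2 * Real.exp (-t) / (c + t)) - c * (t^2 * Real.exp (-t) / (c + t)^2)) ?_ hint ?_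
  · rw [this]; simp
  · intro t ht
    have ht' : 0 ≤ t := ht
    have hne : c + t ≠ 0 := by positivity
    have he : HasDerivAt (fun t : ℝ => t^2 * Real.exp (-t))
        (2 * t * Real.exp (-t) - t^2 * Real.exp (-t)) t := by
      have := (hasDerivAt_pow 2 t).mul ((hasDerivAt_id t).neg.exp)
      refine HasDerivAt.congr_deriv this ?_
      simp; ring
    have hl : HasDerivAt (fun t : ℝ => c + t) 1 t := (hasDerivAt_id t).const_add c
    have := (he.div hl hne).neg.sub ((he.div (hl.pow 2) (pow_ne_zero 2 hne)).const_mul c)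
    refine HasDerivAt.congr_deriv this ?_
    simp only [hg, Pi.pow_apply]
    field_simp
    ring
  · have h0 := Real.tendsto_pow_mul_exp_neg_atTop_nhds_zero 2
    have hb : ∀ n : ℕ, Tendsto (fun t : ℝ => t^2 * Real.exp (-t) / (c + t)^n) atTop (nhds 0) := by
      intro n
      have hbd := h0.mul_const ((c^n)⁻¹)
      rw [zero_mul] at hbd
      refine squeeze_zero' ?_ ?_ hbd
      · filter_upwards [eventually_ge_atTop 0] with t ht
        positivity
      · filter_upwards [eventually_ge_atTop 0] with t ht
        rw [div_eq_mul_inv]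
        gcongr
        linarith
    have := (hb 1).neg.sub ((hb 2).const_mul c)
    simpa using this

lemma s_val (α : ℝ) (hα : 0 < α) (c : ℝ) (hc : 0 < c)
    (hceq : (∫ t in Set.Ioi (0:ℝ), t * Real.exp (-t) / (c + t)^2) = 1/α) (s : ℝ)
    (hs : (s : ℂ) = Hfun α ((-c : ℝ) : ℂ)) :
    s - c^2 = 2 * c^2 * (α * ∫ t in Ioi (0:ℝ), t * Real.exp (-t) / (c + t)^3) := by
  have h1 : (∫ t in Ioi (0:ℝ), ((t * Real.exp (-t) : ℝ) : ℂ) / (((-c : ℝ) : ℂ) - t)) =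
      ((-(∫ t in Ioi (0:ℝ), t * Real.exp (-t) / (c + t)^1) : ℝ) : ℂ) := by
    rw [← integral_neg, ← integral_complex_ofReal]
    refine setIntegral_congr_fun measurableSet_Ioi (fun t ht => ?_)
    push_cast
    rw [← div_neg]
    congr 1
    ring
  unfold Hfun at hs
  rw [h1] at hs
  norm_cast at hs
  have h2 := ibp c hc
  rw [hceq] at h2
  have h3 : α * (1/α) = 1 := mul_one_div_cancel hα.ne'
  rw [hs]
  linear_combination α * h2 + (c + c^2) * h3

/-- `lim_{ξ ↓ s_α} f_α(ξ)/√(ξ − s_α) = √2/(π c_α √(s_α − c_α²))`. -/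
theorem free_gamma_density_asymptotics_at_left_endpoint
    (α : ℝ) (hα : 0 < α) (c : ℝ) (hc : 0 < c)
    (hceq : (∫ t in Set.Ioi (0:ℝ), t * Real.exp (-t) / (c + t)^2) = 1/α)
    (v : ℝ → ℝ) (hv0 : ∀ x ≤ -c, v x = 0)
    (hvpos : ∀ x, -c < x → 0 < v x)
    (hveq : ∀ x, -c < x → Fint x (v x) = 1/α)
    (hvuniq : ∀ x, -c < x → ∀ y, 0 < y → Fint x y = 1/α → y = v x)
    (P : ℝ → ℝ)
    (hP : ∀ x : ℝ, ((P x : ℝ) : ℂ) = Hfun α ((x : ℂ) + (v x : ℝ) * Complex.I))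
    (Pinv : ℝ → ℝ)
    (hPinv₁ : Function.LeftInverse Pinv P)
    (hPinv₂ : Function.RightInverse Pinv P)
    (s : ℝ) (hs : s = P (-c))
    (f : ℝ → ℝ) (hf0 : ∀ ξ ≤ s, f ξ = 0)
    (hf1 : ∀ ξ, s < ξ → f ξ =
      (1 / Real.pi) * (v (Pinv ξ) / ((Pinv ξ)^2 + (v (Pinv ξ))^2))) :
    Filter.Tendsto (fun ξ => f ξ / Real.sqrt (ξ - s))
      (nhdsWithin s (Set.Ioi s))
      (nhds (Real.sqrt 2 / (Real.pi * c * Real.sqrt (s - c^2)))) := by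
  have hzre : ∀ x : ℝ, ((x : ℂ) + (v x : ℝ) * Complex.I).re = x := by intro x; simp
  have hzim : ∀ x : ℝ, ((x : ℂ) + (v x : ℝ) * Complex.I).im = v x := by intro x; simp
  have haw : ∀ x : ℝ, Away ((x : ℂ) + (v x : ℝ) * Complex.I) := by
    intro x
    rcases le_or_gt x (-c) with h | h
    · exact ⟨c, hc, away_of_re hc (by rw [hzre]; exact h)⟩
    · exact away_of_im (by rw [hzim]; exact hvpos x h)
  have hFle : ∀ x, Fint x (v x) ≤ 1/α := by
    intro x
    rcases le_or_gt x (-c) with h | h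
    · have hi := int_normsq (haw x)
      rw [hzre, hzim] at hi
      rw [hv0 x h] at hi ⊢
      rw [← hceq]
      unfold Fint
      refine setIntegral_mono_on hi (int_c c hc 2) measurableSet_Ioi ?_
      intro t ht
      have ht' : 0 < t := ht
      gcongr
      nlinarith
    · exact (hveq x h).le
  have hmono : StrictMono P := by
    intro x y hxy
    have hne : P x ≠ P y := fun h => hxy.ne (hPinv₁.injective h)
    have h1 := H_sub α (haw y) (haw x)
    have h2 := re_A_le α hα (haw y) (haw x) (by rw [hzre, hzim]; exact hFle y)
      (by rw [hzre, hzim]; exact hFle x)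
    rw [← hP, ← hP] at h1
    set B := (1 - α * ∫ t in Ioi (0:ℝ), ((t * Real.exp (-t) : ℝ) : ℂ) /
      (((y : ℂ) + (v y : ℝ) * Complex.I - t) * ((x : ℂ) + (v x : ℝ) * Complex.I - t)) : ℂ) with hB
    have hre := congrArg Complex.re h1
    have him := congrArg Complex.im h1
    simp at hre him
    have hB0 : 0 < B.re^2 + B.im^2 := by
      by_contra hcon
      have e1 : B.re = 0 := by nlinarith [sq_nonneg B.re, sq_nonneg B.im]
      have e2 : B.im = 0 := by nlinarith [sq_nonneg B.re, sq_nonneg B.im]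
      rw [e1, e2] at hre
      apply hne
      linarith
    have hk : (P y - P x) * B.re = (y - x) * (B.re^2 + B.im^2) := by
      linear_combination B.re * hre + B.im * him
    have hp : 0 < (P y - P x) * B.re := by
      rw [hk]; exact mul_pos (by linarith) hB0
    have := pos_of_mul_pos_left hp h2
    linarith
  have hPinvmono : Monotone Pinv := by
    intro a b hab
    rw [← hmono.le_iff_le, hPinv₂ a, hPinv₂ b]
    exact hab
  have hcont : Continuous Pinv := hPinvmono.continuous_of_surjective hPinv₁.surjective
  have hPs : Pinv s = -c := by rw [hs, hPinv₁]
  have hgt : ∀ ξ, s < ξ → -c < Pinv ξ := by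
    intro ξ hξ
    rw [← hmono.lt_iff_lt, hPinv₂ ξ, ← hs]; exact hξ
  have hx : Tendsto Pinv (nhdsWithin s (Ioi s)) (nhds (-c)) := by
    rw [← hPs]; exact hcont.continuousAt.tendsto.mono_left nhdsWithin_le_nhds
  have hmem : ∀ᶠ ξ in nhdsWithin s (Ioi s), s < ξ := self_mem_nhdsWithin
  have hvt : Tendsto (fun ξ => v (Pinv ξ)) (nhdsWithin s (Ioi s)) (nhds 0) := by
    rw [Metric.tendsto_nhds]
    intro ε hε
    have hlt : Fint (-c) ε < 1/α := by
      rw [← hceq]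
      have i1 := int_c c hc 2
      have i2 := int_normsq (z := ((-c : ℝ) : ℂ) + (ε : ℝ) * Complex.I)
        (away_of_im (by simpa using hε))
      simp only [Complex.add_re, Complex.ofReal_re, Complex.re_ofReal_mul, Complex.I_re, mul_zero,
        add_zero, Complex.add_im, Complex.ofReal_im, Complex.im_ofReal_mul, Complex.I_im, mul_one,
        zero_add] at i2
      have h := int_pos_of_pos _ (i1.sub i2) (fun t ht => by
        simp only [Pi.sub_apply, sub_pos]
        have hm : 0 < t * Real.exp (-t) := by positivity
        refine div_lt_div_of_pos_left hm (by positivity) ?_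
        nlinarith [sq_pos_of_pos hε])
      simp only [Pi.sub_apply] at h
      rw [integral_sub i1 i2] at h
      unfold Fint
      linarith
    have hev := hx.eventually ((Fint_tendsto c ε hε).eventually_lt continuousAt_const hlt)
    filter_upwards [hev, hmem] with ξ h1 h2
    have hpos := hvpos _ (hgt ξ h2)
    rw [Real.dist_eq, sub_zero, abs_of_pos hpos]
    by_contra hcon
    push Not at hcon
    have i1 := int_normsq (haw (Pinv ξ))
    rw [hzre, hzim] at i1
    have i2 := int_normsq (z := ((Pinv ξ : ℝ) : ℂ) + (ε : ℝ) * Complex.I)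
      (away_of_im (by simpa using hε))
    simp only [Complex.add_re, Complex.ofReal_re, Complex.re_ofReal_mul, Complex.I_re, mul_zero,
      add_zero, Complex.add_im, Complex.ofReal_im, Complex.im_ofReal_mul, Complex.I_im, mul_one,
      zero_add] at i2
    have hle : Fint (Pinv ξ) (v (Pinv ξ)) ≤ Fint (Pinv ξ) ε := by
      unfold Fint
      refine setIntegral_mono_on i1 i2 measurableSet_Ioi ?_
      intro t ht
      have ht' : 0 < t := ht
      gcongr
    rw [hveq _ (hgt ξ h2)] at hle
    linarith
  have hz : Tendsto (fun ξ => ((Pinv ξ : ℝ) : ℂ) + (v (Pinv ξ) : ℝ) * Complex.I)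
      (nhdsWithin s (Ioi s)) (nhds ((-c : ℝ) : ℂ)) := by
    have h1 := (Complex.continuous_ofReal.tendsto (-c)).comp hx
    have h2 := ((Complex.continuous_ofReal.tendsto 0).comp hvt).mul_const Complex.I
    simpa using h1.add h2
  have hsH : (s : ℂ) = Hfun α ((-c : ℝ) : ℂ) := by
    rw [hs, hP, hv0 (-c) le_rfl]; simp
  have hsval := s_val α hα c hc hceq s hsH
  set J := ∫ t in Ioi (0:ℝ), t * Real.exp (-t) / (c + t)^3 with hJ
  have hJpos : 0 < J := int_pos_of_pos _ (int_c c hc 3) (fun t ht => by positivity)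
  have hK : Tendsto (fun ξ => (α : ℂ) * Kf c (((Pinv ξ : ℝ) : ℂ) + (v (Pinv ξ) : ℝ) * Complex.I))
      (nhdsWithin s (Ioi s)) (nhds ((-(α * J) : ℝ) : ℂ)) := by
    have := ((Kf_tendsto c hc).tendsto.comp hz).const_mul (α : ℂ)
    rw [Kf_val, ← hJ] at this
    have e : ((-(α * J) : ℝ) : ℂ) = (α : ℂ) * ((-J : ℝ) : ℂ) := by push_cast; ring
    rw [e]
    exact this
  set K := fun ξ => (α : ℂ) * Kf c (((Pinv ξ : ℝ) : ℂ) + (v (Pinv ξ) : ℝ) * Complex.I) with hKdef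
  have hkpos : 0 < α * J := mul_pos hα hJpos
  have hKinv : Tendsto (fun ξ => (K ξ)⁻¹) (nhdsWithin s (Ioi s))
      (nhds ((-(α * J)⁻¹ : ℝ) : ℂ)) := by
    have := hK.inv₀ (by exact_mod_cast (neg_lt_zero.mpr hkpos).ne)
    convert this using 2
    push_cast; rw [inv_neg]
  have hlim : Tendsto (fun ξ => (‖(K ξ)⁻¹‖ - ((K ξ)⁻¹).re) / 2) (nhdsWithin s (Ioi s))
      (nhds ((α * J)⁻¹)) := by
    have h1 := hKinv.norm
    have h2 := (Complex.continuous_re.tendsto _).comp hKinv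
    have h3 := (h1.sub h2).div_const 2
    rw [Complex.norm_real, Complex.ofReal_re, Real.norm_eq_abs, abs_neg,
      abs_of_pos (inv_pos.mpr hkpos)] at h3
    have e : ((α * J)⁻¹ - -(α * J)⁻¹) / 2 = (α * J)⁻¹ := by ring
    rw [e] at h3
    exact h3
  have hb : ∀ ξ, s < ξ → v (Pinv ξ) / Real.sqrt (ξ - s) =
      Real.sqrt ((‖(K ξ)⁻¹‖ - ((K ξ)⁻¹).re) / 2) := by
    intro ξ hξ
    have hpos := hvpos _ (hgt ξ hξ)
    have hd : 0 < ξ - s := by linarith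
    have e := H_sub_c α hα c hc hceq (haw (Pinv ξ))
    rw [← hP, hPinv₂ ξ, ← hsH] at e
    set d := ((Pinv ξ : ℝ) : ℂ) + (v (Pinv ξ) : ℝ) * Complex.I - ((-c : ℝ) : ℂ) with hddef
    have e' : ((ξ - s : ℝ) : ℂ) = d^2 * K ξ := by rw [← e]; push_cast; ring
    have hKne : K ξ ≠ 0 := by
      intro h0
      rw [h0, mul_zero] at e'
      exact hd.ne' (by exact_mod_cast e')
    have e2 : d^2 = ((ξ - s : ℝ) : ℂ) * (K ξ)⁻¹ := by
      rw [e']; field_simp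
    have hdre : d.re = Pinv ξ + c := by simp [hddef]
    have hdim : d.im = v (Pinv ξ) := by simp [hddef]
    have en : d.re^2 + d.im^2 = (ξ - s) * ‖(K ξ)⁻¹‖ := by
      have := congrArg norm e2
      rw [norm_pow, ← Complex.normSq_eq_norm_sq, Complex.normSq_apply, norm_mul, Complex.norm_real,
        Real.norm_of_nonneg hd.le] at this
      rw [← this]; ring
    have er : d.re^2 - d.im^2 = (ξ - s) * ((K ξ)⁻¹).re := by
      have := congrArg Complex.re e2
      rw [Complex.re_ofReal_mul, sq, Complex.mul_re] at this
      rw [← this]; ring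
    have hq : (‖(K ξ)⁻¹‖ - ((K ξ)⁻¹).re) / 2 = v (Pinv ξ)^2 / (ξ - s) := by
      rw [← hdim, eq_div_iff hd.ne']
      linear_combination (er - en) / 2
    rw [hq, Real.sqrt_div (sq_nonneg _), Real.sqrt_sq hpos.le]
  have hfin : Tendsto (fun ξ => (1 / Real.pi) *
      (Real.sqrt ((‖(K ξ)⁻¹‖ - ((K ξ)⁻¹).re) / 2) / ((Pinv ξ)^2 + (v (Pinv ξ))^2)))
      (nhdsWithin s (Ioi s)) (nhds ((1 / Real.pi) *
      (Real.sqrt ((α * J)⁻¹) / ((-c)^2 + 0^2)))) := by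
    refine Tendsto.const_mul _ (Tendsto.div hlim.sqrt ((hx.pow 2).add (hvt.pow 2)) ?_)
    have := pow_pos hc 2
    nlinarith
  have hval : Real.sqrt 2 / (Real.pi * c * Real.sqrt (s - c^2)) = (1 / Real.pi) *
      (Real.sqrt ((α * J)⁻¹) / ((-c)^2 + 0^2)) := by
    rw [hsval, Real.sqrt_mul (by positivity), Real.sqrt_mul (by norm_num), Real.sqrt_sq hc.le,
      Real.sqrt_inv]
    have h2 : Real.sqrt 2 ≠ 0 := by positivity
    have h3 : Real.sqrt (α * J) ≠ 0 := by positivity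
    field_simp
    ring
  rw [hval]
  refine hfin.congr' ?_
  filter_upwards [hmem] with ξ hξ
  rw [hf1 ξ hξ, ← hb ξ hξ]
  ring
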